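/- Let a be a base sequence and let r, s be nonnegative reals. Then both j_a(r + s) and j_a(|r − s|) are subsets of the union of the following three sets: j_a(r) ∪ j_a(s); { n : n+1 ∈ j_a(r) ∪ j_a(s) }; and { n : a_n ≠ a_{n+1} } ∪ { n : a_{n+1} ≠ a_{n+2} }. -/

import Mathlib

open Set Filter
open scoped ENNReal

/-- `a₀ a₁ ⋯ a_{n-1}` as a real number: the product of the first `n` terms of the
base sequence (the paper's `a₁ ⋯ a_n`, re-indexed from 0). -/
noncomputable def bProd (a : ℕ → ℕ) (n : ℕ) : ℝ := ∏ k ∈ Finset.range n, (a k : ℝ)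

/-- The `n`-th digit (0-indexed; the paper's `(n+1)`-st digit) of the nonnegative
real `r` in base `a`:  `r_n = ⌊a₁⋯a_n (r - ⌊r⌋)⌋ - a_n ⌊a₁⋯a_{n-1} (r - ⌊r⌋)⌋`. -/
noncomputable def digit (a : ℕ → ℕ) (r : ℝ) (n : ℕ) : ℤ :=
  ⌊bProd a (n + 1) * Int.fract r⌋ - (a n : ℤ) * ⌊bProd a n * Int.fract r⌋

/-- `j_a(r) = { n : r_n ≠ r_{n+1} }`. -/
def jSet (a : ℕ → ℕ) (r : ℝ) : Set ℕ := {n | digit a r n ≠ digit a r (n + 1)}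

/-- An ideal of subsets of ℕ: closed under subsets and finite unions, containing
all singletons (hence nonempty). -/
def IsIdeal (I : Set (Set ℕ)) : Prop :=
  (∀ ⦃x y : Set ℕ⦄, x ∈ I → y ⊆ x → y ∈ I) ∧
  (∀ ⦃x y : Set ℕ⦄, x ∈ I → y ∈ I → x ∪ y ∈ I) ∧
  (∀ n : ℕ, ({n} : Set ℕ) ∈ I)

/-- Translation invariance of a family of subsets of ℕ. -/
def TransInv (I : Set (Set ℕ)) : Prop :=
  ∀ x ∈ I, ({n | ∃ m ∈ x, n = m + 1} ∈ I) ∧ ({n | n + 1 ∈ x} ∈ I)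

/-- A tall family: every infinite set of naturals has an infinite subset in the family. -/
def TallIdeal (I : Set (Set ℕ)) : Prop :=
  ∀ x : Set ℕ, x.Infinite → ∃ y, y ⊆ x ∧ y.Infinite ∧ y ∈ I

/-- The base sequence `a` is adapted to `I` if `{n : a_n ≠ a_{n+1}} ∈ I`. -/
def AdaptedTo (a : ℕ → ℕ) (I : Set (Set ℕ)) : Prop := {n | a n ≠ a (n + 1)} ∈ I

/-- A lower semicontinuous submeasure on subsets of ℕ. -/
def IsLscSubmeasure (φ : Set ℕ → ℝ≥0∞) : Prop :=
  φ ∅ = 0 ∧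
  (∀ ⦃x y : Set ℕ⦄, x ⊆ y → φ x ≤ φ y) ∧
  (∀ x y : Set ℕ, φ (x ∪ y) ≤ φ x + φ y) ∧
  (∀ n : ℕ, 0 < φ {n} ∧ φ {n} < ⊤) ∧
  (∀ x : Set ℕ, φ x = ⨆ n : ℕ, φ (x ∩ {k | k < n}))

/-- `Exh(φ) = { x ⊆ ℕ : φ(x \ {0,…,n-1}) → 0 }`. -/
def Exh (φ : Set ℕ → ℝ≥0∞) : Set (Set ℕ) :=
  {x | Filter.Tendsto (fun n => φ (x \ {k | k < n})) Filter.atTop (nhds 0)}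

/-- `pr(a)`: the set of primes dividing `a_n` for all but finitely many `n`. -/
def prSet (a : ℕ → ℕ) : Set ℕ := {p | p.Prime ∧ ∀ᶠ n in Filter.atTop, p ∣ a n}

/-- A base sequence is uniform if every prime dividing some `a_n` divides `a_n`
for all but finitely many `n`. -/
def UniformBase (a : ℕ → ℕ) : Prop :=
  ∀ p : ℕ, p.Prime → (∃ n, p ∣ a n) → ∀ᶠ n in Filter.atTop, p ∣ a n

/-- `ℚ_a`, viewed as a set of real numbers: fractions `k/l` with every prime
divisor of `l` in `pr(a)`. -/
def Qa (a : ℕ → ℕ) : Set ℝ :=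
  {r | ∃ (k : ℤ) (l : ℕ), 0 < l ∧ (∀ p : ℕ, p.Prime → p ∣ l → p ∈ prSet a) ∧
    r = (k : ℝ) / (l : ℝ)}

/-- `H = { r ∈ ℝ : j_a(|r|) ∈ I }`. -/
def Hset (a : ℕ → ℕ) (I : Set (Set ℕ)) : Set ℝ := {r | jSet a |r| ∈ I}

/-- `ρ(r,s) = φ(j_a(|r-s|)) + |r-s|`. -/
noncomputable def rho (a : ℕ → ℕ) (φ : Set ℕ → ℝ≥0∞) (r s : ℝ) : ℝ :=
  (φ (jSet a |r - s|)).toReal + |r - s|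

theorem bProd_succ (a : ℕ → ℕ) (n : ℕ) : bProd a (n + 1) = a n * bProd a n := by
  rw [bProd, bProd, Finset.prod_range_succ, mul_comm]

/-- The fractional part may be dropped in the definition of the digits. -/
theorem digit_eq (a : ℕ → ℕ) (r : ℝ) (n : ℕ) :
    digit a r n = ⌊bProd a (n + 1) * r⌋ - (a n : ℤ) * ⌊bProd a n * r⌋ := by
  have floor_eq (m : ℕ) : ⌊bProd a m * Int.fract r⌋ =
      ⌊bProd a m * r⌋ - (∏ k ∈ Finset.range m, (a k : ℤ)) * ⌊r⌋ := by
    rw [← Int.floor_sub_intCast]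
    congr 1
    rw [Int.fract, bProd]
    push_cast
    ring
  rw [digit, floor_eq, floor_eq, Finset.prod_range_succ]
  ring

theorem digit_nonneg (a : ℕ → ℕ) (r : ℝ) (n : ℕ) : 0 ≤ digit a r n := by
  rw [digit_eq, sub_nonneg, Int.le_floor, bProd_succ]
  push_cast
  rw [mul_assoc]
  exact mul_le_mul_of_nonneg_left (Int.floor_le _) (Nat.cast_nonneg _)

theorem digit_lt {a : ℕ → ℕ} {n : ℕ} (ha : 0 < a n) (r : ℝ) : digit a r n < a n := by
  rw [digit_eq, sub_lt_iff_lt_add, Int.floor_lt, bProd_succ]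
  push_cast
  have h := mul_lt_mul_of_pos_left (Int.lt_floor_add_one (bProd a n * r))
    (Nat.cast_pos (α := ℝ).2 ha)
  linarith

/-- If all carries take one of the two values `l` and `l + 1`, constant digits produce
constant digits. -/
theorem digit_eq_of_carry {A d l c₀ c₁ c₂ c₃ : ℤ}
    (h₀ : c₀ = l ∨ c₀ = l + 1) (h₁ : c₁ = l ∨ c₁ = l + 1)
    (h₂ : c₂ = l ∨ c₂ = l + 1) (h₃ : c₃ = l ∨ c₃ = l + 1)
    (u₀ : 0 ≤ d + c₁ - A * c₀) (v₀ : d + c₁ - A * c₀ < A)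
    (u₁ : 0 ≤ d + c₂ - A * c₁) (v₁ : d + c₂ - A * c₁ < A)
    (u₂ : 0 ≤ d + c₃ - A * c₂) (v₂ : d + c₃ - A * c₂ < A) :
    d + c₁ - A * c₀ = d + c₂ - A * c₁ := by
  rcases h₀ with rfl | rfl <;> rcases h₁ with rfl | rfl <;> rcases h₂ with rfl | rfl <;>
    rcases h₃ with h | h <;> first | rfl | (exfalso; linarith)

/-- Closure of constancy of digits under an operation whose carries take two values. -/
theorem jSet_subset_of_carry {a : ℕ → ℕ} (ha : ∀ n, 0 < a n) {r s t : ℝ} {l ε : ℤ} {c : ℕ → ℤ}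
    (hc : ∀ n, c n = l ∨ c n = l + 1)
    (ht : ∀ n, digit a t n = digit a r n + ε * digit a s n + c (n + 1) - a n * c n) :
    jSet a t ⊆
      (jSet a r ∪ jSet a s) ∪ {n | n + 1 ∈ jSet a r ∪ jSet a s} ∪
        ({n | a n ≠ a (n + 1)} ∪ {n | a (n + 1) ≠ a (n + 2)}) := by
  intro n hn
  by_contra h
  simp only [jSet, mem_union, mem_ofPred_eq, not_or, not_not] at h hn
  obtain ⟨⟨⟨r₀, s₀⟩, r₁, s₁⟩, a₀, a₁⟩ := h
  apply hn
  have u₀ := digit_nonneg a t n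
  have v₀ := digit_lt (ha n) t
  have u₁ := digit_nonneg a t (n + 1)
  have v₁ := digit_lt (ha (n + 1)) t
  have u₂ := digit_nonneg a t (n + 2)
  have v₂ := digit_lt (ha (n + 2)) t
  rw [ht] at u₀ v₀ u₁ v₁ u₂ v₂
  rw [ht, ht]
  simp only [add_assoc, Nat.reduceAdd] at *
  rw [← r₁, ← s₁, ← a₁, ← r₀, ← s₀, ← a₀] at u₂ v₂
  rw [← r₀, ← s₀, ← a₀] at u₁ v₁ ⊢
  simp only [← add_assoc] at *
  exact digit_eq_of_carry (hc _) (hc _) (hc _) (hc _) u₀ v₀ u₁ v₁ u₂ v₂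

theorem jSet_add_subset {a : ℕ → ℕ} (ha : ∀ n, 0 < a n) (r s : ℝ) :
    jSet a (r + s) ⊆
      (jSet a r ∪ jSet a s) ∪ {n | n + 1 ∈ jSet a r ∪ jSet a s} ∪
        ({n | a n ≠ a (n + 1)} ∪ {n | a (n + 1) ≠ a (n + 2)}) := by
  refine jSet_subset_of_carry ha (l := 0) (ε := 1)
    (c := fun n ↦ ⌊bProd a n * (r + s)⌋ - ⌊bProd a n * r⌋ - ⌊bProd a n * s⌋)
    (fun n ↦ ?_) (fun n ↦ ?_)
  · have h₁ := Int.le_floor_add (bProd a n * r) (bProd a n * s)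
    have h₂ := Int.le_floor_add_floor (bProd a n * r) (bProd a n * s)
    rw [← mul_add] at h₁ h₂
    omega
  · simp only [digit_eq]
    ring

theorem jSet_sub_subset {a : ℕ → ℕ} (ha : ∀ n, 0 < a n) (r s : ℝ) :
    jSet a (r - s) ⊆
      (jSet a r ∪ jSet a s) ∪ {n | n + 1 ∈ jSet a r ∪ jSet a s} ∪
        ({n | a n ≠ a (n + 1)} ∪ {n | a (n + 1) ≠ a (n + 2)}) := by
  refine jSet_subset_of_carry ha (l := -1) (ε := -1)
    (c := fun n ↦ ⌊bProd a n * (r - s)⌋ - ⌊bProd a n * r⌋ + ⌊bProd a n * s⌋)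
    (fun n ↦ ?_) (fun n ↦ ?_)
  · have h₁ := Int.le_floor_add (bProd a n * (r - s)) (bProd a n * s)
    have h₂ := Int.le_floor_add_floor (bProd a n * (r - s)) (bProd a n * s)
    rw [← mul_add, sub_add_cancel] at h₁ h₂
    omega
  · simp only [digit_eq]
    ring

/-- Lemma on `j_a` and the algebraic operations. -/
theorem jSet_add_sub (a : ℕ → ℕ) (ha : ∀ n, 2 ≤ a n)
    (r s : ℝ) (hr : 0 ≤ r) (hs : 0 ≤ s) :
    jSet a (r + s) ⊆
      (jSet a r ∪ jSet a s) ∪ {n | n + 1 ∈ jSet a r ∪ jSet a s} ∪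
        ({n | a n ≠ a (n + 1)} ∪ {n | a (n + 1) ≠ a (n + 2)}) ∧
    jSet a |r - s| ⊆
      (jSet a r ∪ jSet a s) ∪ {n | n + 1 ∈ jSet a r ∪ jSet a s} ∪
        ({n | a n ≠ a (n + 1)} ∪ {n | a (n + 1) ≠ a (n + 2)}) := by
  have ha' (n : ℕ) : 0 < a n := two_pos.trans_le (ha n)
  refine ⟨jSet_add_subset ha' r s, ?_⟩
  rcases abs_choice (r - s) with h | h
  · rw [h]
    exact jSet_sub_subset ha' r s
  · rw [h, neg_sub, union_comm (jSet a r)]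
    exact jSet_sub_subset ha' s r
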